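/- Let M be a matroid on an n-element set E with rank r(M), and let Q'_M be the polynomial associated to a Q'-datum for M. Then for all rational numbers x, y with x ≠ 0, y ≠ 0 and x + y ≠ 1: Q'_M(x,y) = (x^{n−r(M)}·y^{r(M)}/(x+y−1)) · T_M((x+y−1)/y, (x+y−1)/x). -/

import Mathlib

open scoped Pointwise
open Finset

noncomputable section

/-- The standard simplex `Δ = conv{e_i : i ∈ E}` in `ℝ^E`. -/
def stdSimplexSet (α : Type*) [Fintype α] [DecidableEq α] : Set (α → ℝ) :=
  convexHull ℝ {x : α → ℝ | ∃ i : α, x = Pi.single i (1 : ℝ)}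

/-- The number of lattice points (points of `ℤ^E`) in a subset of `ℝ^E`. -/
def latticeCount {α : Type*} (P : Set (α → ℝ)) : ℕ :=
  Set.ncard {q : α → ℤ | (fun i => (q i : ℝ)) ∈ P}

/-- `Qcount P t u` is the number of lattice points of `P + uΔ + t∇`. -/
def Qcount {α : Type*} [Fintype α] [DecidableEq α] (P : Set (α → ℝ)) (t u : ℕ) : ℕ :=
  latticeCount (P + (u : ℝ) • stdSimplexSet α + (t : ℝ) • (-stdSimplexSet α))

/-- A polymatroid on a finite ground set, given by its rank function. -/
structure PolyMatroid (α : Type*) [Fintype α] [DecidableEq α] where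
  rk : Finset α → ℕ
  rk_empty : rk ∅ = 0
  rk_mono : ∀ ⦃S T : Finset α⦄, S ⊆ T → rk S ≤ rk T
  rk_submod : ∀ S T : Finset α, rk (S ∪ T) + rk (S ∩ T) ≤ rk S + rk T

variable {α : Type*} [Fintype α] [DecidableEq α]

/-- A basis of a matroid (an independent spanning set). -/
def PolyMatroid.IsBasis (M : PolyMatroid α) (B : Finset α) : Prop :=
  M.rk B = B.card ∧ M.rk B = M.rk Finset.univ

/-- The indicator vector of a finite set. -/
def indicatorVec {α : Type*} [DecidableEq α] (B : Finset α) : α → ℝ :=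
  fun i => if i ∈ B then 1 else 0

/-- The base polytope of a matroid: the convex hull of indicator vectors of bases. -/
def matroidPolytope (M : PolyMatroid α) : Set (α → ℝ) :=
  convexHull ℝ {x : α → ℝ | ∃ B : Finset α, M.IsBasis B ∧ x = indicatorVec B}

/-- The base polytope of a polymatroid, by its inequality description. -/
def PolyMatroid.polytope (M : PolyMatroid α) : Set (α → ℝ) :=
  {x | (∑ i, x i) = (M.rk Finset.univ : ℝ) ∧
    ∀ S : Finset α, (∑ i ∈ S, x i) ≤ (M.rk S : ℝ)}

/-- `c : ℕ × ℕ → ℤ` is a `Q'`-datum for the counting function `Q` if it is finitely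
supported and interpolates `Q` in the binomial basis. -/
def IsQdatumFun (Q : ℕ → ℕ → ℕ) (c : ℕ × ℕ → ℤ) : Prop :=
  (Function.support c).Finite ∧
    ∀ t u : ℕ, (Q t u : ℤ) = ∑ᶠ p : ℕ × ℕ, c p * (t.choose p.1 : ℤ) * (u.choose p.2 : ℤ)

/-- A `Q'`-datum for the lattice-point counting function of the polytope `P`. -/
def IsQdatum (P : Set (α → ℝ)) (c : ℕ × ℕ → ℤ) : Prop :=
  IsQdatumFun (Qcount P) c

/-- The polynomial `Q'` associated to a `Q'`-datum, as a function on `ℚ × ℚ`. -/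
def Qprime (c : ℕ × ℕ → ℤ) (x y : ℚ) : ℚ :=
  ∑ᶠ p : ℕ × ℕ, (c p : ℚ) * (x - 1) ^ p.1 * (y - 1) ^ p.2

/-- The polynomial `Q'` associated to a `Q'`-datum, as a polynomial in two variables. -/
def QprimePoly (c : ℕ × ℕ → ℤ) : MvPolynomial (Fin 2) ℤ :=
  ∑ᶠ p : ℕ × ℕ,
    MvPolynomial.C (c p) * (MvPolynomial.X 0 - 1) ^ p.1 * (MvPolynomial.X 1 - 1) ^ p.2

/-- The Tutte polynomial of a matroid, as a function on `ℚ × ℚ`. -/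
def TuttePoly (M : PolyMatroid α) (x y : ℚ) : ℚ :=
  ∑ S : Finset α,
    (x - 1) ^ (M.rk Finset.univ - M.rk S) * (y - 1) ^ (S.card - M.rk S)

namespace PolyMatroid

theorem rk_le_card (M : PolyMatroid α) (hmat : ∀ i, M.rk {i} ≤ 1) (S : Finset α) :
    M.rk S ≤ #S := by
  induction S using Finset.induction_on with
  | empty => simp [M.rk_empty]
  | insert a s ha ih =>
    have h₁ := M.rk_submod {a} s
    have h₂ := hmat a
    rw [card_insert_of_notMem ha, Finset.insert_eq]
    omega

theorem rk_eq_card_of_subset (M : PolyMatroid α) (hmat : ∀ i, M.rk {i} ≤ 1) {A B : Finset α}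
    (hAB : A ⊆ B) (hB : M.rk B = #B) : M.rk A = #A := by
  have h₁ := M.rk_submod A (B \ A)
  rw [union_sdiff_of_subset hAB] at h₁
  have h₂ := M.rk_le_card hmat (B \ A)
  have h₃ := M.rk_le_card hmat A
  have h₄ := card_sdiff_add_card_eq_card hAB
  omega

theorem exists_indep_extension (M : PolyMatroid α) (hmat : ∀ i, M.rk {i} ≤ 1) {I : Finset α}
    (hI : M.rk I = #I) (D : Finset α) :
    ∃ J, I ⊆ J ∧ J ⊆ I ∪ D ∧ M.rk J = #J ∧ M.rk J = M.rk (I ∪ D) := by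
  induction D using Finset.induction_on with
  | empty => exact ⟨I, by simp [hI]⟩
  | insert a D _ ih =>
    obtain ⟨J, hIJ, hJ, hcard, hrk⟩ := ih
    have hsub : I ∪ D ⊆ I ∪ insert a D := union_subset_union_right (subset_insert a D)
    have hmono := M.rk_mono hsub
    by_cases heq : M.rk (I ∪ insert a D) = M.rk (I ∪ D)
    · exact ⟨J, hIJ, hJ.trans hsub, hcard, by omega⟩
    · refine ⟨insert a J, hIJ.trans (subset_insert a J), ?_, ?_⟩
      · exact insert_subset (by simp) (hJ.trans hsub)
      · have h₁ := M.rk_submod (insert a J) (I ∪ D)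
        have h₂ : insert a J ∪ (I ∪ D) = I ∪ insert a D := by
          rw [insert_union, union_eq_right.2 hJ, union_insert]
        have h₃ : M.rk J ≤ M.rk (insert a J ∩ (I ∪ D)) :=
          M.rk_mono (subset_inter (subset_insert a J) hJ)
        have h₄ := M.rk_le_card hmat (insert a J)
        have h₅ := card_insert_le a J
        have h₆ : M.rk (I ∪ insert a D) ≤ M.rk {a} + M.rk (I ∪ D) := by
          have := M.rk_submod {a} (I ∪ D)
          rw [← insert_eq, ← union_insert] at this
          omega
        have h₇ := hmat a
        rw [h₂] at h₁
        omega

theorem exists_isBasis_card_inter (M : PolyMatroid α) (hmat : ∀ i, M.rk {i} ≤ 1)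
    (S : Finset α) : ∃ B, M.IsBasis B ∧ #(B ∩ S) = M.rk S := by
  obtain ⟨I, -, hIS, hI, hrk⟩ :=
    M.exists_indep_extension hmat (I := ∅) (by simp [M.rk_empty]) S
  rw [empty_union] at hIS hrk
  obtain ⟨B, hIB, -, hB, hBrk⟩ := M.exists_indep_extension hmat hI univ
  rw [union_eq_right.2 (subset_univ I)] at hBrk
  refine ⟨B, ⟨hB, hBrk⟩, le_antisymm ?_ ?_⟩
  · rw [← M.rk_eq_card_of_subset hmat inter_subset_left hB]
    exact M.rk_mono inter_subset_right
  · rw [← hrk, hI]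
    exact card_le_card (subset_inter hIB hIS)

end PolyMatroid

theorem sum_indicatorVec {β : Type*} [DecidableEq β] (B S : Finset β) :
    ∑ i ∈ S, indicatorVec B i = #(B ∩ S) := by
  simp [indicatorVec, Finset.inter_comm]

theorem PolyMatroid.matroidPolytope_subset_polytope (M : PolyMatroid α)
    (hmat : ∀ i, M.rk {i} ≤ 1) : matroidPolytope M ⊆ M.polytope := by
  refine convexHull_min ?_ ?_
  · rintro _ ⟨B, ⟨hB, hBrk⟩, rfl⟩
    refine ⟨?_, fun S => ?_⟩
    · rw [sum_indicatorVec, inter_univ, ← hB, hBrk]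
    · rw [sum_indicatorVec, ← M.rk_eq_card_of_subset hmat inter_subset_left hB]
      exact_mod_cast M.rk_mono inter_subset_right
  · rintro x ⟨hx, hxS⟩ y ⟨hy, hyS⟩ a b ha hb hab
    refine ⟨?_, fun S => ?_⟩
    · simp only [Pi.add_apply, Pi.smul_apply, smul_eq_mul, sum_add_distrib, ← mul_sum, hx, hy]
      rw [← add_mul, hab, one_mul]
    · simp only [Pi.add_apply, Pi.smul_apply, smul_eq_mul, sum_add_distrib, ← mul_sum]
      calc _ ≤ a * (M.rk S : ℝ) + b * M.rk S := by gcongr <;> [exact hxS S; exact hyS S]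
        _ = M.rk S := by rw [← add_mul, hab, one_mul]

theorem stdSimplexSet_eq_stdSimplex : stdSimplexSet α = stdSimplex ℝ α := by
  rw [← convexHull_rangle_single_eq_stdSimplex, stdSimplexSet]
  congr 1
  ext x
  simp [eq_comm]

theorem mem_smul_stdSimplexSet [Nonempty α] (u : ℕ) (f : α → ℝ) :
    f ∈ (u : ℝ) • stdSimplexSet α ↔ (∀ i, 0 ≤ f i) ∧ ∑ i, f i = u := by
  rw [stdSimplexSet_eq_stdSimplex]
  constructor
  · rintro ⟨d, ⟨hd, hsum⟩, rfl⟩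
    refine ⟨fun i => mul_nonneg u.cast_nonneg (hd i), ?_⟩
    simp [← mul_sum, hsum]
  · rintro ⟨hf, hsum⟩
    rcases u.eq_zero_or_pos with rfl | hu
    · have h₀ : f = 0 := by
        funext i
        exact (sum_eq_zero_iff_of_nonneg fun i _ => hf i).1 (by simpa using hsum) i (mem_univ i)
      obtain ⟨i⟩ := ‹Nonempty α›
      exact ⟨Pi.single i 1, single_mem_stdSimplex ℝ i, by simp [h₀]⟩
    · have hu' : (u : ℝ) ≠ 0 := by positivity
      refine ⟨(u : ℝ)⁻¹ • f, ⟨fun i => ?_, ?_⟩, smul_inv_smul₀ hu' f⟩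
      · exact mul_nonneg (by positivity) (hf i)
      · simp [← mul_sum, hsum, hu']

/-- The set of coordinates at which an integer vector is positive. -/
def posSupport (q : α → ℤ) : Finset α := {i | 0 < q i}

theorem mem_posSupport {β : Type*} [Fintype β] {q : β → ℤ} {i : β} :
    i ∈ posSupport q ↔ 0 < q i := by
  simp [posSupport]

namespace PolyMatroid

/-- The integer vectors at bounded distance from the bases, as described by the rank of their
positive support. -/
def reach (M : PolyMatroid α) (t u : ℕ) : Set (α → ℤ) :=
  {q | ∑ i, q i + t = M.rk univ + u ∧
    ∑ i ∈ posSupport q, q i ≤ u + M.rk (posSupport q)}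

theorem mem_minkowski_iff_mem_reach [Nonempty α] (M : PolyMatroid α)
    (hmat : ∀ i, M.rk {i} ≤ 1) (t u : ℕ) (q : α → ℤ) :
    (fun i => (q i : ℝ)) ∈
        matroidPolytope M + (u : ℝ) • stdSimplexSet α + (t : ℝ) • (-stdSimplexSet α) ↔
      q ∈ M.reach t u := by
  rw [Set.smul_set_neg]
  constructor
  · rintro ⟨_, ⟨p, hp, f, hf, rfl⟩, g, hg, hq⟩
    rw [Set.mem_neg, mem_smul_stdSimplexSet] at hg
    rw [mem_smul_stdSimplexSet] at hf
    obtain ⟨hp, hpS⟩ := M.matroidPolytope_subset_polytope hmat hp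
    have hqi : ∀ i, (q i : ℝ) = p i + f i + g i := fun i => (congrFun hq i).symm
    have hgS : ∑ i, g i = -t := by simpa [neg_eq_iff_eq_neg] using hg.2
    refine ⟨?_, ?_⟩
    · have : (∑ i, (q i : ℝ)) + t = M.rk univ + u := by
        simp only [hqi, sum_add_distrib, hp, hf.2, hgS]
        ring
      exact_mod_cast this
    · have : (∑ i ∈ posSupport q, (q i : ℝ)) ≤ u + M.rk (posSupport q) := by
        simp only [hqi, sum_add_distrib]
        have h₁ := hpS (posSupport q)
        have h₂ : ∑ i ∈ posSupport q, f i ≤ u :=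
          hf.2 ▸ sum_le_sum_of_subset_of_nonneg (subset_univ _) fun i _ _ => hf.1 i
        have h₃ : ∑ i ∈ posSupport q, g i ≤ 0 :=
          sum_nonpos fun i _ => by simpa using hg.1 i
        linarith
      exact_mod_cast this
  · rintro ⟨hsum, hpos⟩
    obtain ⟨B, hB, hBS⟩ := M.exists_isBasis_card_inter hmat (posSupport q)
    obtain ⟨i₀⟩ := ‹Nonempty α›
    set d : α → ℤ := fun i => q i - if i ∈ B then 1 else 0 with hd
    have hdpos : ∑ i, (d i)⁺ = ∑ i ∈ posSupport q, q i - M.rk (posSupport q) := by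
      have h₁ : ∀ i, (d i)⁺ = if i ∈ posSupport q then d i else 0 := by
        intro i
        simp only [mem_posSupport, hd]
        split_ifs <;> first | (apply posPart_of_nonneg; omega) | (apply posPart_of_nonpos; omega)
      rw [sum_congr rfl fun i _ => h₁ i, sum_ite_mem, univ_inter, hd, sum_sub_distrib, ← hBS]
      simp [Finset.inter_comm]
    have hdsum : ∑ i, d i = (u : ℤ) - t := by
      rw [hd, sum_sub_distrib]
      have : (#B : ℤ) = M.rk univ := by rw [← hB.2, hB.1]
      simp only [sum_ite_mem, univ_inter, sum_const, nsmul_eq_mul, mul_one, this]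
      linarith
    have hdneg : ∑ i, (d i)⁻ = ∑ i, (d i)⁺ - (u - t) := by
      rw [← hdsum, ← sum_sub_distrib]
      refine sum_congr rfl fun i _ => ?_
      have := posPart_sub_negPart (d i)
      linarith
    set k : ℤ := u - ∑ i, (d i)⁺ with hk
    have hk₀ : 0 ≤ k := by rw [hk, hdpos]; linarith
    have hsingle : ∀ i, 0 ≤ (Pi.single i₀ k : α → ℤ) i := fun i => by
      rw [Pi.single_apply]; split_ifs <;> omega
    refine ⟨_, ⟨indicatorVec B, subset_convexHull ℝ _ ⟨B, hB, rfl⟩,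
      fun i => (((d i)⁺ + Pi.single (M := fun _ => ℤ) i₀ k i : ℤ) : ℝ), ?_, rfl⟩,
      fun i => ((-((d i)⁻ + Pi.single (M := fun _ => ℤ) i₀ k i) : ℤ) : ℝ), ?_, ?_⟩
    · rw [mem_smul_stdSimplexSet]
      refine ⟨fun i => ?_, ?_⟩
      · exact_mod_cast add_nonneg (posPart_nonneg _) (hsingle i)
      · have : ∑ i, ((d i)⁺ + Pi.single (M := fun _ => ℤ) i₀ k i) = u := by
          rw [sum_add_distrib, sum_pi_single']; simp [hk]
        exact_mod_cast this
    · rw [Set.mem_neg, mem_smul_stdSimplexSet]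
      refine ⟨fun i => ?_, ?_⟩
      · have := add_nonneg (negPart_nonneg (d i)) (hsingle i)
        simp only [Pi.neg_apply, Int.cast_neg, neg_neg]
        exact_mod_cast this
      · have : ∑ i, ((d i)⁻ + Pi.single (M := fun _ => ℤ) i₀ k i) = t := by
          rw [sum_add_distrib, sum_pi_single', hdneg]; simp [hk]
        simp only [Pi.neg_apply, Int.cast_neg, neg_neg]
        exact_mod_cast this
    · funext i
      have h₁ := posPart_sub_negPart (d i)
      have h₂ : q i = (if i ∈ B then 1 else 0) + ((d i)⁺ + Pi.single (M := fun _ => ℤ) i₀ k i) +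
          -((d i)⁻ + Pi.single (M := fun _ => ℤ) i₀ k i) := by
        have : d i = q i - if i ∈ B then 1 else 0 := rfl
        linarith
      simp only [Pi.add_apply, indicatorVec]
      conv_rhs => rw [h₂]
      push_cast
      rfl

theorem Qcount_matroidPolytope [Nonempty α] (M : PolyMatroid α)
    (hmat : ∀ i, M.rk {i} ≤ 1) (t u : ℕ) :
    Qcount (matroidPolytope M) t u = (M.reach t u).ncard := by
  rw [Qcount, latticeCount]
  congr 1
  ext q
  exact M.mem_minkowski_iff_mem_reach hmat t u q

end PolyMatroid

/-- The integer vector which is `f + 1` on `S` and `-g` off `S`. -/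
def signedVector (S : Finset α) (p : (α →₀ ℕ) × (α →₀ ℕ)) : α → ℤ :=
  fun i => if i ∈ S then p.1 i + 1 else -p.2 i

theorem posSupport_signedVector (S : Finset α) (p : (α →₀ ℕ) × (α →₀ ℕ)) :
    posSupport (signedVector S p) = S := by
  ext i
  rw [mem_posSupport, signedVector]
  split_ifs with h <;> simp only [h, iff_true, iff_false] <;> omega

theorem sum_signedVector {β : Type*} [DecidableEq β] (S : Finset β) (p : (β →₀ ℕ) × (β →₀ ℕ)) :
    ∑ i ∈ S, signedVector S p i = ∑ i ∈ S, (p.1 i : ℤ) + #S := by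
  have h : ∀ i ∈ S, signedVector S p i = p.1 i + 1 := fun i hi => if_pos hi
  rw [sum_congr rfl h, sum_add_distrib]
  simp

theorem sum_compl_signedVector (S : Finset α) (p : (α →₀ ℕ) × (α →₀ ℕ)) :
    ∑ i ∈ Sᶜ, signedVector S p i = -∑ i ∈ Sᶜ, (p.2 i : ℤ) := by
  have h : ∀ i ∈ Sᶜ, signedVector S p i = -p.2 i := fun i hi => if_neg (mem_compl.1 hi)
  rw [sum_congr rfl h, sum_neg_distrib]

theorem signedVector_injOn (S : Finset α) (m n : ℕ) :
    Set.InjOn (signedVector S)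
      (finsuppAntidiag S m ×ˢ finsuppAntidiag Sᶜ n : Finset ((α →₀ ℕ) × (α →₀ ℕ))) := by
  rintro ⟨f, g⟩ h ⟨f', g'⟩ h' heq
  simp only [coe_product, Set.mem_prod, mem_coe, mem_finsuppAntidiag] at h h'
  have hi : ∀ i, signedVector S (f, g) i = signedVector S (f', g') i := congrFun heq
  simp only [signedVector] at hi
  have hz : ∀ {k : α →₀ ℕ} {T : Finset α}, k.support ⊆ T → ∀ i ∉ T, k i = 0 :=
    fun hk i hiT => Finsupp.notMem_support_iff.1 fun hmem => hiT (hk hmem)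
  refine Prod.ext (Finsupp.ext fun i => ?_) (Finsupp.ext fun i => ?_) <;> have := hi i
  · by_cases hS : i ∈ S
    · simp only [hS, if_true] at this
      simp only
      omega
    · simp only [hz h.1.2 i hS, hz h'.1.2 i hS]
  · by_cases hS : i ∈ S
    · have hS' : i ∉ Sᶜ := by simpa using hS
      simp only [hz h.2.2 i hS', hz h'.2.2 i hS']
    · simp only [hS, if_false] at this
      simp only
      omega

theorem exists_signedVector (q : α → ℤ) :
    ∃ p : (α →₀ ℕ) × (α →₀ ℕ), p.1.support ⊆ posSupport q ∧ p.2.support ⊆ (posSupport q)ᶜ ∧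
      signedVector (posSupport q) p = q := by
  refine ⟨(Finsupp.equivFunOnFinite.symm fun i => (q i - 1).toNat,
    Finsupp.equivFunOnFinite.symm fun i => (-q i).toNat), ?_, ?_, ?_⟩
  · intro i hi
    simp only [Finsupp.mem_support_iff, Finsupp.equivFunOnFinite_symm_apply_apply] at hi
    rw [mem_posSupport]
    omega
  · intro i hi
    simp only [Finsupp.mem_support_iff, Finsupp.equivFunOnFinite_symm_apply_apply] at hi
    rw [mem_compl, mem_posSupport]
    omega
  · funext i
    simp only [signedVector, mem_posSupport, Finsupp.equivFunOnFinite_symm_apply_apply]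
    split_ifs <;> omega

namespace PolyMatroid

/-- The vectors with positive support `S` lying in `M.reach t u` but not in
`M.reach (t - 1) (u - 1)`. -/
def layer (M : PolyMatroid α) (t u : ℕ) (S : Finset α) : Finset (α → ℤ) :=
  if M.rk univ - M.rk S ≤ t ∧ #S - M.rk S ≤ u then
    (finsuppAntidiag S (u - (#S - M.rk S)) ×ˢ
      finsuppAntidiag Sᶜ (t - (M.rk univ - M.rk S))).image (signedVector S)
  else ∅

theorem card_layer (M : PolyMatroid α) (t u : ℕ) (S : Finset α) :
    #(M.layer t u S) = if M.rk univ - M.rk S ≤ t ∧ #S - M.rk S ≤ u then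
      #(finsuppAntidiag S (u - (#S - M.rk S))) *
        #(finsuppAntidiag Sᶜ (t - (M.rk univ - M.rk S))) else 0 := by
  rw [layer]
  split_ifs
  · rw [card_image_of_injOn (signedVector_injOn S _ _), card_product]
  · rfl

theorem mem_layer (M : PolyMatroid α) (hmat : ∀ i, M.rk {i} ≤ 1) (t u : ℕ) (S : Finset α)
    (q : α → ℤ) : q ∈ M.layer t u S ↔ posSupport q = S ∧ ∑ i ∈ S, q i = u + M.rk S ∧
      ∑ i, q i + t = M.rk univ + u := by
  have hcard := M.rk_le_card hmat S
  have hmono := M.rk_mono (subset_univ S)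
  constructor
  · intro h
    rw [layer] at h
    split_ifs at h with hcond
    · obtain ⟨p, hp, rfl⟩ := mem_image.1 h
      simp only [mem_product, mem_finsuppAntidiag] at hp
      have h₁ : ∑ i ∈ S, (p.1 i : ℤ) = (u - (#S - M.rk S) : ℕ) := by exact_mod_cast hp.1.1
      have h₂ : ∑ i ∈ Sᶜ, (p.2 i : ℤ) = (t - (M.rk univ - M.rk S) : ℕ) := by
        exact_mod_cast hp.2.1
      rw [← sum_add_sum_compl S, sum_signedVector, sum_compl_signedVector, h₁, h₂]
      exact ⟨posSupport_signedVector S p, by omega, by omega⟩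
    · simp at h
  · rintro ⟨hS, hpos, hsum⟩
    obtain ⟨p, hp₁, hp₂, hp⟩ := exists_signedVector q
    rw [hS] at hp hp₁ hp₂
    rw [← sum_add_sum_compl S, hpos] at hsum
    rw [← hp, sum_signedVector] at hpos
    rw [← hp, sum_compl_signedVector] at hsum
    have h₁ : ((∑ i ∈ S, p.1 i : ℕ) : ℤ) + #S = u + M.rk S := by exact_mod_cast hpos
    have h₂ : (u : ℤ) + M.rk S + -((∑ i ∈ Sᶜ, p.2 i : ℕ) : ℤ) + t = M.rk univ + u := by
      exact_mod_cast hsum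
    rw [layer, if_pos (by omega), mem_image]
    refine ⟨p, ?_, hp⟩
    have h₃ : ∑ i ∈ S, p.1 i = u - (#S - M.rk S) := by omega
    have h₄ : ∑ i ∈ Sᶜ, p.2 i = t - (M.rk univ - M.rk S) := by omega
    simp only [mem_product, mem_finsuppAntidiag]
    exact ⟨⟨h₃, hp₁⟩, h₄, hp₂⟩

theorem pairwiseDisjoint_layer (M : PolyMatroid α) (hmat : ∀ i, M.rk {i} ≤ 1) (t u : ℕ) :
    Set.PairwiseDisjoint (Set.univ : Set (Finset α)) (M.layer t u) := by
  intro S _ T _ hST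
  refine Finset.disjoint_left.2 fun q hS hT => hST ?_
  rw [← ((M.mem_layer hmat t u S q).1 hS).1, ((M.mem_layer hmat t u T q).1 hT).1]

/-- The vectors lying in `M.reach t u` but not in `M.reach (t - 1) (u - 1)`. -/
def frontier (M : PolyMatroid α) (t u : ℕ) : Finset (α → ℤ) :=
  univ.biUnion (M.layer t u)

theorem card_frontier (M : PolyMatroid α) (hmat : ∀ i, M.rk {i} ≤ 1) (t u : ℕ) :
    #(M.frontier t u) = ∑ S, #(M.layer t u S) :=
  card_biUnion fun _ _ _ _ h => M.pairwiseDisjoint_layer hmat t u trivial trivial h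

theorem mem_frontier (M : PolyMatroid α) (hmat : ∀ i, M.rk {i} ≤ 1) (t u : ℕ) (q : α → ℤ) :
    q ∈ M.frontier t u ↔ ∑ i, q i + t = M.rk univ + u ∧
      ∑ i ∈ posSupport q, q i = u + M.rk (posSupport q) := by
  simp only [frontier, mem_biUnion, mem_univ, true_and, M.mem_layer hmat]
  constructor
  · rintro ⟨S, rfl, h₁, h₂⟩
    exact ⟨h₂, h₁⟩
  · rintro ⟨h₁, h₂⟩
    exact ⟨_, rfl, h₂, h₁⟩

theorem reach_zero_left (M : PolyMatroid α) (hmat : ∀ i, M.rk {i} ≤ 1) (u : ℕ) :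
    M.reach 0 u = M.frontier 0 u := by
  ext q
  rw [mem_coe, M.mem_frontier hmat]
  refine ⟨fun ⟨h₁, h₂⟩ => ⟨h₁, le_antisymm h₂ ?_⟩, fun ⟨h₁, h₂⟩ => ⟨h₁, h₂.le⟩⟩
  have hneg : ∑ i ∈ (posSupport q)ᶜ, q i ≤ 0 := sum_nonpos fun i hi => by
    rw [mem_compl, mem_posSupport] at hi
    omega
  rw [← sum_add_sum_compl (posSupport q)] at h₁
  have hmono := M.rk_mono (subset_univ (posSupport q))
  omega

theorem reach_zero_right (M : PolyMatroid α) (hmat : ∀ i, M.rk {i} ≤ 1) (t : ℕ) :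
    M.reach t 0 = M.frontier t 0 := by
  ext q
  rw [mem_coe, M.mem_frontier hmat]
  refine ⟨fun ⟨h₁, h₂⟩ => ⟨h₁, le_antisymm h₂ ?_⟩, fun ⟨h₁, h₂⟩ => ⟨h₁, h₂.le⟩⟩
  have hcard := M.rk_le_card hmat (posSupport q)
  have hge : (#(posSupport q) : ℤ) ≤ ∑ i ∈ posSupport q, q i := by
    rw [cast_card]
    exact sum_le_sum fun i hi => mem_posSupport.1 hi
  omega

theorem reach_succ_succ (M : PolyMatroid α) (hmat : ∀ i, M.rk {i} ≤ 1) (t u : ℕ) :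
    M.reach (t + 1) (u + 1) = ↑(M.frontier (t + 1) (u + 1)) ∪ M.reach t u := by
  ext q
  rw [Set.mem_union, mem_coe, M.mem_frontier hmat]
  simp only [reach, Set.mem_ofPred_eq]
  push_cast
  omega

theorem disjoint_frontier_reach (M : PolyMatroid α) (hmat : ∀ i, M.rk {i} ≤ 1) (t u : ℕ) :
    Disjoint (↑(M.frontier (t + 1) (u + 1)) : Set (α → ℤ)) (M.reach t u) := by
  refine Set.disjoint_left.2 fun q hq hq' => ?_
  rw [mem_coe, M.mem_frontier hmat] at hq
  have := hq.2
  have := hq'.2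
  push_cast at *
  omega

theorem finite_reach (M : PolyMatroid α) (hmat : ∀ i, M.rk {i} ≤ 1) (t u : ℕ) :
    (M.reach t u).Finite := by
  induction t generalizing u with
  | zero => exact M.reach_zero_left hmat u ▸ finite_toSet _
  | succ t ih =>
    cases u with
    | zero => exact M.reach_zero_right hmat (t + 1) ▸ finite_toSet _
    | succ u => exact M.reach_succ_succ hmat t u ▸ (finite_toSet _).union (ih u)

theorem ncard_reach_succ_succ (M : PolyMatroid α) (hmat : ∀ i, M.rk {i} ≤ 1) (t u : ℕ) :
    (M.reach (t + 1) (u + 1)).ncard = #(M.frontier (t + 1) (u + 1)) + (M.reach t u).ncard := by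
  rw [M.reach_succ_succ hmat, Set.ncard_union_eq (M.disjoint_frontier_reach hmat t u)
    (finite_toSet _) (M.finite_reach hmat t u), Set.ncard_coe_finset]

end PolyMatroid

open PowerSeries in
theorem PowerSeries.mk_choose_mul_one_sub_pow (R : Type*) [CommRing R] (i : ℕ) :
    (mk fun t => (t.choose i : R)) * (1 - X) ^ (i + 1) = X ^ i := by
  have h : (mk fun t => (t.choose i : R)) = X ^ i * mk fun t => ((i + t).choose i : R) := by
    ext t
    rw [coeff_X_pow_mul', coeff_mk]
    split_ifs with hit
    · rw [coeff_mk, Nat.add_sub_cancel' hit]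
    · rw [Nat.choose_eq_zero_of_lt (by omega), Nat.cast_zero]
  rw [h, mul_assoc, mk_add_choose_mul_one_sub_pow_eq_one, mul_one]

open PowerSeries in
theorem PowerSeries.coeff_mk_one_pow_card {β : Type*} [DecidableEq β] (R : Type*) [CommRing R]
    (T : Finset β) (n : ℕ) : coeff n ((mk 1 : R⟦X⟧) ^ #T) = #(finsuppAntidiag T n) := by
  rw [← prod_const, coeff_prod]
  simp

section GeneratingFunction

open PowerSeries

theorem PolyMatroid.coeff_coeff_frontier_series (M : PolyMatroid α) (hmat : ∀ i, M.rk {i} ≤ 1)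
    (t u : ℕ) :
    coeff u (coeff t (∑ S : Finset α, X ^ (M.rk univ - M.rk S) * (PowerSeries.mk 1) ^ #Sᶜ *
      C (X ^ (#S - M.rk S) * (PowerSeries.mk 1) ^ #S) : ℚ⟦X⟧⟦X⟧)) = #(M.frontier t u) := by
  rw [M.card_frontier hmat, map_sum, map_sum, Nat.cast_sum]
  refine sum_congr rfl fun S _ => ?_
  rw [coeff_mul_C, coeff_X_pow_mul', M.card_layer]
  by_cases h₁ : M.rk univ - M.rk S ≤ t
  · by_cases h₂ : #S - M.rk S ≤ u
    · rw [if_pos h₁, if_pos ⟨h₁, h₂⟩, coeff_mk_one_pow_card, ← map_natCast (C (R := ℚ)),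
        coeff_C_mul, coeff_X_pow_mul', if_pos h₂, coeff_mk_one_pow_card]
      push_cast
      ring
    · rw [if_pos h₁, if_neg (by tauto), coeff_mk_one_pow_card, ← map_natCast (C (R := ℚ)),
        coeff_C_mul, coeff_X_pow_mul', if_neg h₂]
      simp
  · rw [if_neg h₁, if_neg (by tauto)]
    simp

theorem PolyMatroid.reach_series (M : PolyMatroid α) (hmat : ∀ i, M.rk {i} ≤ 1) :
    (1 - X * C X) * (PowerSeries.mk fun t => PowerSeries.mk fun u => ((M.reach t u).ncard : ℚ)) =
      ∑ S : Finset α, X ^ (M.rk univ - M.rk S) * (PowerSeries.mk 1) ^ #Sᶜ *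
        C (X ^ (#S - M.rk S) * (PowerSeries.mk 1) ^ #S) := by
  ext t u
  rw [M.coeff_coeff_frontier_series hmat, sub_mul, one_mul, mul_assoc]
  cases t with
  | zero => simp [M.reach_zero_left hmat]
  | succ t =>
    rw [map_sub, coeff_succ_X_mul, coeff_C_mul, coeff_mk, coeff_mk]
    cases u with
    | zero => simp [M.reach_zero_right hmat]
    | succ u =>
      rw [map_sub, coeff_succ_X_mul, coeff_mk, coeff_mk, M.ncard_reach_succ_succ hmat]
      push_cast
      ring

theorem IsQdatumFun.series_eq {Q : ℕ → ℕ → ℕ} {c : ℕ × ℕ → ℤ} (hc : IsQdatumFun Q c) :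
    (PowerSeries.mk fun t => PowerSeries.mk fun u => (Q t u : ℚ)) = ∑ p ∈ hc.1.toFinset,
      (c p : ℚ⟦X⟧⟦X⟧) * ((PowerSeries.mk fun t => (t.choose p.1 : ℚ⟦X⟧)) *
        C (PowerSeries.mk fun u => (u.choose p.2 : ℚ))) := by
  ext t u
  have h := hc.2 t u
  rw [finsum_eq_sum_of_support_subset (s := hc.1.toFinset)] at h
  · have h' : (Q t u : ℚ) = ((Q t u : ℤ) : ℚ) := by simp
    rw [coeff_mk, coeff_mk, h', h, map_sum, map_sum, Int.cast_sum]
    refine sum_congr rfl fun p _ => ?_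
    rw [← map_intCast (C (R := ℚ⟦X⟧)), coeff_C_mul, coeff_mul_C, coeff_mk,
      ← map_intCast (C (R := ℚ)), coeff_C_mul, ← map_natCast (C (R := ℚ)), coeff_C_mul, coeff_mk]
    push_cast
    ring
  · intro p hp
    rw [Set.Finite.coe_toFinset]
    exact left_ne_zero_of_mul (left_ne_zero_of_mul hp)

/-- The embedding of polynomials in two variables into power series in two variables. -/
def bivariateToPowerSeries : Polynomial (Polynomial ℚ) →+* ℚ⟦X⟧⟦X⟧ :=
  Polynomial.coeToPowerSeries.ringHom.comp
    (Polynomial.mapRingHom Polynomial.coeToPowerSeries.ringHom)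

theorem bivariateToPowerSeries_injective : Function.Injective bivariateToPowerSeries := by
  refine Polynomial.coe_injective _ |>.comp (Polynomial.map_injective _ ?_)
  exact Polynomial.coe_injective ℚ

theorem bivariateToPowerSeries_X : bivariateToPowerSeries Polynomial.X = X := by
  simp [bivariateToPowerSeries]

theorem bivariateToPowerSeries_C_X :
    bivariateToPowerSeries (Polynomial.C Polynomial.X) = C X := by
  simp [bivariateToPowerSeries]

end GeneratingFunction

/-- Clearing the denominators in the two expressions of the generating function of the lattice
point counts gives an identity of polynomials. -/
theorem PolyMatroid.polynomial_identity (M : PolyMatroid α) (hmat : ∀ i, M.rk {i} ≤ 1)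
    {c : ℕ × ℕ → ℤ} (hc : IsQdatumFun (fun t u => (M.reach t u).ncard) c) {N : ℕ}
    (hN : ∀ p ∈ hc.1.toFinset, p.1 ≤ N ∧ p.2 ≤ N) (hcard : Fintype.card α ≤ N)
    (a b : ℚ) :
    (1 - a * b) * ∑ p ∈ hc.1.toFinset, (c p : ℚ) *
        (a ^ p.1 * (1 - a) ^ (N - p.1) * (b ^ p.2 * (1 - b) ^ (N - p.2))) =
      ∑ S : Finset α, a ^ (M.rk univ - M.rk S) * (1 - a) ^ (N + 1 - #Sᶜ) *
        (b ^ (#S - M.rk S) * (1 - b) ^ (N + 1 - #S)) := by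
  suffices h : (1 - Polynomial.X * Polynomial.C Polynomial.X) * ∑ p ∈ hc.1.toFinset,
        (c p : Polynomial (Polynomial ℚ)) *
        (Polynomial.X ^ p.1 * (1 - Polynomial.X) ^ (N - p.1) *
          (Polynomial.C Polynomial.X ^ p.2 * (1 - Polynomial.C Polynomial.X) ^ (N - p.2))) =
      ∑ S : Finset α, Polynomial.X ^ (M.rk univ - M.rk S) *
        (1 - Polynomial.X) ^ (N + 1 - #Sᶜ) * (Polynomial.C Polynomial.X ^ (#S - M.rk S) *
          (1 - Polynomial.C Polynomial.X) ^ (N + 1 - #S)) by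
    have h' := congrArg (Polynomial.eval₂RingHom (Polynomial.evalRingHom b) a) h
    simp only [map_mul, map_sub, map_one, map_sum, map_pow, map_intCast] at h'
    simpa using h'
  apply bivariateToPowerSeries_injective
  simp only [map_mul, map_sub, map_one, map_sum, map_pow, map_intCast, bivariateToPowerSeries_X,
    bivariateToPowerSeries_C_X]
  have hkey := congrArg (· * ((1 - PowerSeries.X) ^ (N + 1) *
    (1 - PowerSeries.C PowerSeries.X) ^ (N + 1))) (M.reach_series hmat)
  simp only [hc.series_eq] at hkey
  rw [mul_assoc, sum_mul, sum_mul] at hkey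
  convert hkey using 1
  · congr 1
    refine sum_congr rfl fun p hp => ?_
    have h₁ := PowerSeries.mk_choose_mul_one_sub_pow (PowerSeries ℚ) p.1
    have h₂ := congrArg (PowerSeries.C (R := PowerSeries ℚ))
      (PowerSeries.mk_choose_mul_one_sub_pow ℚ p.2)
    simp only [map_mul, map_sub, map_one, map_pow] at h₂
    obtain ⟨k, hk⟩ := Nat.exists_eq_add_of_le (hN p hp).1
    obtain ⟨l, hl⟩ := Nat.exists_eq_add_of_le (hN p hp).2
    have h₃ : (1 - PowerSeries.X : PowerSeries (PowerSeries ℚ)) ^ (N + 1) =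
        (1 - PowerSeries.X) ^ (p.1 + 1) * (1 - PowerSeries.X) ^ k := by
      rw [← pow_add]; congr 1; omega
    have h₄ : (1 - PowerSeries.C PowerSeries.X : PowerSeries (PowerSeries ℚ)) ^ (N + 1) =
        (1 - PowerSeries.C PowerSeries.X) ^ (p.2 + 1) *
          (1 - PowerSeries.C PowerSeries.X) ^ l := by
      rw [← pow_add]; congr 1; omega
    rw [← h₁, ← h₂, show N - p.1 = k by omega, show N - p.2 = l by omega, h₃, h₄]
    ring
  · refine sum_congr rfl fun S _ => ?_
    have h₁ := PowerSeries.mk_one_mul_one_sub_eq_one (PowerSeries ℚ)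
    have h₂ := congrArg (PowerSeries.C (R := PowerSeries ℚ))
      (PowerSeries.mk_one_mul_one_sub_eq_one ℚ)
    simp only [map_mul, map_sub, map_one] at h₂
    obtain ⟨k, hk⟩ := Nat.exists_eq_add_of_le ((card_le_univ Sᶜ).trans hcard)
    obtain ⟨l, hl⟩ := Nat.exists_eq_add_of_le ((card_le_univ S).trans hcard)
    rw [show N + 1 - #Sᶜ = k + 1 by omega, show N + 1 - #S = l + 1 by omega]
    have h₃ := congrArg (· ^ #Sᶜ) h₁
    have h₄ := congrArg (· ^ #S) h₂
    simp only [mul_pow, one_pow] at h₃ h₄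
    rw [map_mul, map_pow, map_pow]
    have h₅ : (1 - PowerSeries.X : PowerSeries (PowerSeries ℚ)) ^ (N + 1) =
        (1 - PowerSeries.X) ^ #Sᶜ * (1 - PowerSeries.X) ^ (k + 1) := by
      rw [← pow_add]; congr 1; omega
    have h₆ : (1 - PowerSeries.C PowerSeries.X : PowerSeries (PowerSeries ℚ)) ^ (N + 1) =
        (1 - PowerSeries.C PowerSeries.X) ^ #S *
          (1 - PowerSeries.C PowerSeries.X) ^ (l + 1) := by
      rw [← pow_add]; congr 1; omega
    rw [h₅, h₆]
    have cancel : ∀ {E F g h s q P Q : PowerSeries (PowerSeries ℚ)}, g * s = 1 → h * q = 1 →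
        E * P * (F * Q) = E * g * (F * h) * (s * P * (q * Q)) := by
      intro E F g h s q P Q hg hh
      linear_combination -(E * P * F * Q) * (h * q * hg + hh)
    exact cancel h₃ h₄

theorem Qprime_eq_sum {Q : ℕ → ℕ → ℕ} {c : ℕ × ℕ → ℤ} (hc : IsQdatumFun Q c) (x y : ℚ) :
    Qprime c x y = ∑ p ∈ hc.1.toFinset, (c p : ℚ) * (x - 1) ^ p.1 * (y - 1) ^ p.2 := by
  refine finsum_eq_sum_of_support_subset _ fun p hp => ?_
  rw [Set.Finite.coe_toFinset]
  exact Int.cast_ne_zero.1 (left_ne_zero_of_mul (left_ne_zero_of_mul hp))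

/-- For a matroid `M` on an `n`-element set, the polynomial `Q'_M`
associated to a `Q'`-datum for `M` satisfies
`Q'_M(x,y) = x^(n−r(M)) y^(r(M)) / (x+y−1) · T_M((x+y−1)/y, (x+y−1)/x)`
for all rationals `x ≠ 0`, `y ≠ 0` with `x + y ≠ 1`. -/
theorem stmt_1 {α : Type*} [Fintype α] [DecidableEq α] [Nonempty α]
    (M : PolyMatroid α) (hmat : ∀ i : α, M.rk {i} ≤ 1)
    (c : ℕ × ℕ → ℤ) (hc : IsQdatum (matroidPolytope M) c)
    (x y : ℚ) (hx : x ≠ 0) (hy : y ≠ 0) (hxy : x + y ≠ 1) :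
    Qprime c x y =
      x ^ (Fintype.card α - M.rk Finset.univ) * y ^ (M.rk Finset.univ) / (x + y - 1) *
        TuttePoly M ((x + y - 1) / y) ((x + y - 1) / x) := by
  have hc' : IsQdatumFun (fun t u => (M.reach t u).ncard) c := by
    simpa only [IsQdatum, funext₂ (M.Qcount_matroidPolytope hmat)] using hc
  set N := hc'.1.toFinset.sup (fun p => p.1 + p.2) + Fintype.card α with hNdef
  have hN : ∀ p ∈ hc'.1.toFinset, p.1 ≤ N ∧ p.2 ≤ N := fun p hp => by
    have : p.1 + p.2 ≤ hc'.1.toFinset.sup (fun p => p.1 + p.2) :=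
      le_sup (f := fun p : ℕ × ℕ => p.1 + p.2) hp
    omega
  have key := M.polynomial_identity hmat hc' hN (by omega) ((x - 1) / x) ((y - 1) / y)
  have hxa : 1 - (x - 1) / x = 1 / x := by field_simp; ring
  have hyb : 1 - (y - 1) / y = 1 / y := by field_simp; ring
  have hxyab : 1 - (x - 1) / x * ((y - 1) / y) = (x + y - 1) / (x * y) := by field_simp; ring
  have hT₁ : (x + y - 1) / y - 1 = (x - 1) / y := by field_simp; ring
  have hT₂ : (x + y - 1) / x - 1 = (y - 1) / x := by field_simp; ring
  have hleft : ∀ p ∈ hc'.1.toFinset, (c p : ℚ) * (((x - 1) / x) ^ p.1 * (1 / x) ^ (N - p.1) *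
      (((y - 1) / y) ^ p.2 * (1 / y) ^ (N - p.2))) =
      (c p : ℚ) * (x - 1) ^ p.1 * (y - 1) ^ p.2 / (x ^ N * y ^ N) := fun p hp => by
    obtain ⟨k, hk⟩ := Nat.exists_eq_add_of_le (hN p hp).1
    obtain ⟨l, hl⟩ := Nat.exists_eq_add_of_le (hN p hp).2
    have hxN : x ^ N = x ^ p.1 * x ^ k := by rw [← pow_add, ← hk]
    have hyN : y ^ N = y ^ p.2 * y ^ l := by rw [← pow_add, ← hl]
    rw [hxN, hyN, show N - p.1 = k by omega, show N - p.2 = l by omega]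
    simp only [div_pow, one_pow]
    field_simp
  have hright : ∀ S : Finset α, ((x - 1) / x) ^ (M.rk univ - M.rk S) * (1 / x) ^ (N + 1 - #Sᶜ) *
      (((y - 1) / y) ^ (#S - M.rk S) * (1 / y) ^ (N + 1 - #S)) =
      x ^ (Fintype.card α - M.rk univ) * y ^ M.rk univ *
        (((x - 1) / y) ^ (M.rk univ - M.rk S) * ((y - 1) / x) ^ (#S - M.rk S)) /
        (x ^ (N + 1) * y ^ (N + 1)) := fun S => by
    have hsub := M.rk_submod S Sᶜ
    rw [union_compl] at hsub
    have hcompl := M.rk_le_card hmat Sᶜ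
    have hcard := M.rk_le_card hmat S
    have hmono := M.rk_mono (subset_univ S)
    have hadd := card_add_card_compl S
    obtain ⟨e, he⟩ := Nat.exists_eq_add_of_le hmono
    obtain ⟨d, hd⟩ := Nat.exists_eq_add_of_le hcard
    obtain ⟨m, hm⟩ := Nat.exists_eq_add_of_le (show e ≤ #Sᶜ by omega)
    obtain ⟨k, hk⟩ := Nat.exists_eq_add_of_le (show #Sᶜ ≤ N + 1 by omega)
    obtain ⟨l, hl⟩ := Nat.exists_eq_add_of_le (show #S ≤ N + 1 by omega)
    have hxN : x ^ (N + 1) = x ^ e * x ^ m * x ^ k := by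
      rw [← pow_add, ← pow_add]; congr 1; omega
    have hyN : y ^ (N + 1) = y ^ M.rk S * y ^ d * y ^ l := by
      rw [← pow_add, ← pow_add]; congr 1; omega
    rw [hxN, hyN, show N + 1 - #Sᶜ = k by omega, show N + 1 - #S = l by omega,
      show M.rk univ - M.rk S = e by omega, show #S - M.rk S = d by omega,
      show Fintype.card α - M.rk univ = m + d by omega, he, pow_add, pow_add]
    simp only [div_pow, one_pow]
    field_simp
  rw [hxa, hyb, hxyab, sum_congr rfl hleft, sum_congr rfl fun S _ => hright S, ← sum_div,
    ← sum_div, ← mul_sum, ← Qprime_eq_sum hc'] at key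
  have hxy' : x + y - 1 ≠ 0 := fun h => hxy (by linarith)
  simp only [TuttePoly, hT₁, hT₂]
  rw [pow_succ, pow_succ] at key
  generalize (∑ S : Finset α, ((x - 1) / y) ^ (M.rk univ - M.rk S) *
    ((y - 1) / x) ^ (#S - M.rk S)) = T at key ⊢
  field_simp at key ⊢
  linear_combination key

end
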